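/- Let S be a countable distributive 0-semilattice, i.e., a countable conical refinement monoid in which x + x = x for every x. Then there exist a dimension monoid N (an inductive limit of a sequence of simplicial monoids (ℤ₊)^{r_j} along monoid homomorphisms) and a surjective monoid homomorphism α : N → S such that for all x, y ∈ N, x ∝ y in N if and only if α(x) ≤ α(y) in the algebraic order of S; consequently the maximal semilattice quotient ∇(N) = N/≍ (where x ≍ y iff x ∝ y and y ∝ x) is isomorphic to S. -/

import Mathlib

/-- The algebraic preorder on an additive commutative monoid. -/
def AlgLE {M : Type*} [AddCommMonoid M] (x y : M) : Prop := ∃ z : M, x + z = y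

/-- `x ∝ y` : `x ≤ n • y` for some natural number `n ≥ 1`. -/
def Propto {M : Type*} [AddCommMonoid M] (x y : M) : Prop :=
  ∃ n : ℕ, 1 ≤ n ∧ AlgLE x (n • y)

/-- A refinement monoid. -/
def IsRefinement (M : Type*) [AddCommMonoid M] : Prop :=
  ∀ x₁ x₂ y₁ y₂ : M, x₁ + x₂ = y₁ + y₂ →
    ∃ z₁₁ z₁₂ z₂₁ z₂₂ : M,
      x₁ = z₁₁ + z₁₂ ∧ x₂ = z₂₁ + z₂₂ ∧ y₁ = z₁₁ + z₂₁ ∧ y₂ = z₁₂ + z₂₂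

/-- A conical monoid: `x + y = 0` implies `x = y = 0`. -/
def IsConical (M : Type*) [AddCommMonoid M] : Prop :=
  ∀ x y : M, x + y = 0 → x = 0 ∧ y = 0

/-- The composite `β_{j+k-1} ∘ ⋯ ∘ β_j` of the connecting maps. -/
def iterComp (r : ℕ → ℕ) (β : ∀ j : ℕ, (Fin (r j) → ℕ) →+ (Fin (r (j + 1)) → ℕ))
    (j : ℕ) : ∀ k : ℕ, (Fin (r j) → ℕ) →+ (Fin (r (j + k)) → ℕ)
  | 0 => AddMonoidHom.id _
  | k + 1 => (β (j + k)).comp (iterComp r β j k)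

/-- `Δ`, together with maps `φ_j : (ℤ₊)^{r_j} → Δ`, is the inductive limit of the
sequence of simplicial monoids `(ℤ₊)^{r_j}` along the connecting maps `β_j`.
A monoid arising in this way is a dimension monoid. -/
structure IsInductiveLimit (r : ℕ → ℕ)
    (β : ∀ j : ℕ, (Fin (r j) → ℕ) →+ (Fin (r (j + 1)) → ℕ))
    (Δ : Type*) [AddCommMonoid Δ] (φ : ∀ j : ℕ, (Fin (r j) → ℕ) →+ Δ) : Prop where
  comp_eq : ∀ j : ℕ, (φ (j + 1)).comp (β j) = φ j
  covers : ∀ d : Δ, ∃ (j : ℕ) (x : Fin (r j) → ℕ), φ j x = d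
  eventually_eq : ∀ (j : ℕ) (x y : Fin (r j) → ℕ), φ j x = φ j y →
    ∃ k : ℕ, iterComp r β j k x = iterComp r β j k y

section Order

variable {M N : Type*} [AddCommMonoid M] [AddCommMonoid N]

theorem AlgLE.refl (x : M) : AlgLE x x := ⟨0, add_zero x⟩

theorem AlgLE.trans {x y z : M} (hxy : AlgLE x y) (hyz : AlgLE y z) : AlgLE x z := by
  obtain ⟨a, rfl⟩ := hxy
  obtain ⟨b, rfl⟩ := hyz
  exact ⟨a + b, (add_assoc x a b).symm⟩

theorem AlgLE.add {x y x' y' : M} (h : AlgLE x y) (h' : AlgLE x' y') :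
    AlgLE (x + x') (y + y') := by
  obtain ⟨a, rfl⟩ := h
  obtain ⟨b, rfl⟩ := h'
  exact ⟨a + b, add_add_add_comm x x' a b⟩

theorem AlgLE.nsmul {x y : M} (h : AlgLE x y) (n : ℕ) : AlgLE (n • x) (n • y) := by
  obtain ⟨a, rfl⟩ := h
  exact ⟨n • a, (nsmul_add x a n).symm⟩

theorem AlgLE.map {x y : M} (f : M →+ N) (h : AlgLE x y) : AlgLE (f x) (f y) := by
  obtain ⟨a, rfl⟩ := h
  exact ⟨f a, (map_add f x a).symm⟩

theorem AlgLE.propto {x y : M} (h : AlgLE x y) : Propto x y := ⟨1, le_rfl, by rwa [one_nsmul]⟩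

theorem Propto.trans {x y z : M} (hxy : Propto x y) (hyz : Propto y z) : Propto x z := by
  obtain ⟨n, hn, h⟩ := hxy
  obtain ⟨m, hm, h'⟩ := hyz
  exact ⟨n * m, Nat.mul_pos hn hm, h.trans (by rw [mul_comm, mul_nsmul]; exact h'.nsmul n)⟩

theorem Propto.map {x y : M} (f : M →+ N) (h : Propto x y) : Propto (f x) (f y) := by
  obtain ⟨n, hn, h⟩ := h
  exact ⟨n, hn, map_nsmul f n y ▸ h.map f⟩

theorem Propto.zero_left (y : M) : Propto 0 y := AlgLE.propto ⟨y, zero_add y⟩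

theorem Propto.add_left {x x' y : M} (h : Propto x y) (h' : Propto x' y) :
    Propto (x + x') y := by
  obtain ⟨n, hn, h⟩ := h
  obtain ⟨m, hm, h'⟩ := h'
  exact ⟨n + m, by omega, add_nsmul y n m ▸ h.add h'⟩

theorem Propto.sum_left {ι : Type*} {s : Finset ι} {f : ι → M} {y : M}
    (h : ∀ i ∈ s, Propto (f i) y) : Propto (∑ i ∈ s, f i) y :=
  Finset.sum_induction f (Propto · y) (fun _ _ => Propto.add_left) (Propto.zero_left y) h

theorem Propto.nsmul_left {x y : M} (h : Propto x y) (n : ℕ) : Propto (n • x) y := by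
  simpa using Propto.sum_left (s := Finset.range n) (f := fun _ => x) fun _ _ => h

theorem nsmul_eq_self_of_idem (hidem : ∀ x : M, x + x = x) {n : ℕ} (hn : 1 ≤ n) (x : M) :
    n • x = x := by
  induction n, hn using Nat.le_induction with
  | base => exact one_nsmul x
  | succ n _ ih => rw [succ_nsmul, ih, hidem]

theorem Propto.algLE_of_idem (hidem : ∀ x : M, x + x = x) {x y : M} (h : Propto x y) :
    AlgLE x y := by
  obtain ⟨n, hn, h⟩ := h
  rwa [nsmul_eq_self_of_idem hidem hn] at h

theorem AlgLE.add_eq_of_idem (hidem : ∀ x : M, x + x = x) {x y : M} (h : AlgLE x y) :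
    x + y = y := by
  obtain ⟨a, rfl⟩ := h
  rw [← add_assoc, hidem]

theorem AlgLE.antisymm_of_idem (hidem : ∀ x : M, x + x = x) {x y : M} (h : AlgLE x y)
    (h' : AlgLE y x) : x = y := by
  rw [← h'.add_eq_of_idem hidem, add_comm, h.add_eq_of_idem hidem]

/-- The Riesz decomposition property of refinement monoids. -/
theorem IsRefinement.exists_sum_eq (hR : IsRefinement M) (hC : IsConical M)
    {ι : Type*} [DecidableEq ι] (f : ι → M) (s : Finset ι) (a : M) (h : AlgLE a (∑ j ∈ s, f j)) :
    ∃ u : ι → M, a = ∑ j ∈ s, u j ∧ ∀ j ∈ s, AlgLE (u j) (f j) := by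
  induction s using Finset.induction_on generalizing a with
  | empty =>
    obtain ⟨z, hz⟩ := h
    exact ⟨f, (hC a z hz).1, by simp⟩
  | insert i s hi ih =>
    obtain ⟨z, hz⟩ := h
    rw [Finset.sum_insert hi] at hz
    obtain ⟨a₁, a₂, z₁, z₂, rfl, -, hf, hs⟩ := hR _ _ _ _ hz
    obtain ⟨u, rfl, hu⟩ := ih a₂ ⟨z₂, hs.symm⟩
    refine ⟨Function.update u i a₁, ?_, ?_⟩
    · rw [Finset.sum_insert hi, Function.update_self, Finset.sum_update_of_notMem hi]
    · intro j hj
      obtain rfl | hj := Finset.mem_insert.1 hj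
      · exact ⟨z₁, by rw [Function.update_self, hf]⟩
      · rw [Function.update_of_ne (ne_of_mem_of_not_mem hj hi)]
        exact hu j hj

end Order

section Simplicial

theorem algLE_single {ι : Type*} [DecidableEq ι] {x : ι → ℕ} {i : ι}
    (hi : x i ≠ 0) : AlgLE (Pi.single i 1) x := by
  refine ⟨x - Pi.single i 1, add_tsub_cancel_of_le ?_⟩
  intro j
  obtain rfl | hj := eq_or_ne j i
  · simpa using Nat.one_le_iff_ne_zero.2 hi
  · simp [hj]

variable {ι M : Type*} [Fintype ι] [AddCommMonoid M]

/-- The homomorphism from a simplicial monoid with prescribed values on the basis. -/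
def simplicialLift (v : ι → M) : (ι → ℕ) →+ M := (Fintype.linearCombination ℕ v).toAddMonoidHom

theorem simplicialLift_apply (v : ι → M) (x : ι → ℕ) : simplicialLift v x = ∑ i, x i • v i := rfl

@[simp]
theorem simplicialLift_single [DecidableEq ι] (v : ι → M) (i : ι) :
    simplicialLift v (Pi.single i 1) = v i := by
  simp [simplicialLift]

variable [DecidableEq ι]

/-- The indicator of a finite set, as an element of a simplicial monoid. -/
def simplicialIndicator (s : Finset ι) : ι → ℕ := ∑ i ∈ s, Pi.single i 1

theorem eq_sum_nsmul_single (x : ι → ℕ) : x = ∑ i, x i • (Pi.single i 1 : ι → ℕ) := by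
  simpa [← Pi.single_smul] using (Finset.univ_sum_single x).symm

theorem propto_simplicialIndicator (x : ι → ℕ) :
    Propto x (simplicialIndicator {i | x i ≠ 0}) := by
  conv_lhs => rw [eq_sum_nsmul_single x]
  refine Propto.sum_left fun i _ => ?_
  by_cases hi : x i = 0
  · rw [hi, zero_nsmul]
    exact Propto.zero_left _
  · have hmem : i ∈ ({i | x i ≠ 0} : Finset ι) := Finset.mem_filter.2 ⟨Finset.mem_univ i, hi⟩
    refine Propto.nsmul_left (AlgLE.propto ?_) _
    exact ⟨_, Finset.add_sum_erase _ (fun i => (Pi.single i 1 : ι → ℕ)) hmem⟩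

theorem simplicialIndicator_propto (x : ι → ℕ) :
    Propto (simplicialIndicator {i | x i ≠ 0}) x :=
  Propto.sum_left fun _ hi => (algLE_single (by simpa using hi)).propto

end Simplicial

section Extension

variable {S : Type*} [AddCommMonoid S]

theorem exists_extension_of_element (hC : IsConical S) (hR : IsRefinement S)
    (hidem : ∀ x : S, x + x = x) {ι : Type} [Fintype ι] (F : (ι → ℕ) →+ S) (y : ι → ℕ) :
    ∃ (κ : Type) (_ : Fintype κ) (β : (ι → ℕ) →+ (κ → ℕ)) (G : (κ → ℕ) →+ S),
      G.comp β = F ∧ ∀ x, AlgLE (F x) (F y) → Propto (β x) (β y) := by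
  classical
  let f : ι → S := fun i => F (Pi.single i 1)
  let s : Finset ι := {i | y i ≠ 0}
  let t : Finset ι := {i | y i = 0 ∧ AlgLE (f i) (F y)}
  have hsum : AlgLE (F y) (∑ j ∈ s, f j) := by
    have := ((propto_simplicialIndicator y).map F).algLE_of_idem hidem
    rwa [simplicialIndicator, map_sum] at this
  have hu : ∀ i, ∃ u : ι → S, i ∈ t → f i = ∑ j ∈ s, u j ∧ ∀ j ∈ s, AlgLE (u j) (f j) := by
    intro i
    by_cases hi : i ∈ t
    · obtain ⟨u, hu⟩ := hR.exists_sum_eq hC f s (f i) ((Finset.mem_filter.1 hi).2.2.trans hsum)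
      exact ⟨u, fun _ => hu⟩
    · exact ⟨f, fun h => absurd h hi⟩
  choose u hu using hu
  let B : ι → ι ⊕ ι × ι → ℕ := fun k =>
    if k ∈ t then ∑ j ∈ s, Pi.single (Sum.inr (k, j)) 1
    else Pi.single (Sum.inl k) 1 +
      if k ∈ s then ∑ i ∈ t, Pi.single (Sum.inr (i, k)) 1 else 0
  have hBt : ∀ k ∈ t, B k = ∑ j ∈ s, Pi.single (Sum.inr (k, j)) 1 := fun k hk => if_pos hk
  have hBs : ∀ k ∈ s, ∀ i ∈ t, AlgLE (Pi.single (Sum.inr (i, k)) 1) (B k) := by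
    intro k hk i hi
    have hkt : k ∉ t := fun h => (Finset.mem_filter.1 hk).2 (Finset.mem_filter.1 h).2.1
    simp only [B, if_neg hkt, if_pos hk]
    exact AlgLE.trans ⟨_, Finset.add_sum_erase t (fun i => Pi.single (Sum.inr (i, k)) 1) hi⟩
      ⟨_, add_comm _ _⟩
  have hBy : ∀ k ∈ s, AlgLE (B k) (simplicialLift B y) := by
    intro k hk
    simpa using (algLE_single (Finset.mem_filter.1 hk).2).map (simplicialLift B)
  refine ⟨ι ⊕ ι × ι, inferInstance, simplicialLift B,
    simplicialLift (Sum.elim f fun p => u p.1 p.2), ?_, fun x hx => ?_⟩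
  · refine AddMonoidHom.functions_ext' _ _ _ fun k => AddMonoidHom.ext_nat ?_
    simp only [AddMonoidHom.comp_apply, AddMonoidHom.single_apply, simplicialLift_single, B]
    split_ifs with hk hks
    · simp only [map_sum, simplicialLift_single, Sum.elim_inr]
      exact (hu k hk).1.symm
    · simp only [map_add, map_sum, simplicialLift_single, Sum.elim_inr, Sum.elim_inl]
      rw [add_comm]
      refine AlgLE.add_eq_of_idem hidem (Propto.algLE_of_idem hidem ?_)
      exact Propto.sum_left fun i hi => ((hu i hi).2 k hks).propto
    · simp [f]
  · rw [simplicialLift_apply]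
    refine Propto.sum_left fun i _ => ?_
    by_cases hxi : x i = 0
    · rw [hxi, zero_nsmul]
      exact Propto.zero_left _
    refine Propto.nsmul_left ?_ _
    by_cases hyi : y i = 0
    · have hi : i ∈ t :=
        Finset.mem_filter.2 ⟨Finset.mem_univ _, hyi, ((algLE_single hxi).map F).trans hx⟩
      rw [hBt i hi]
      exact Propto.sum_left fun j hj => ((hBs j hj i hi).trans (hBy j hj)).propto
    · exact (hBy i (Finset.mem_filter.2 ⟨Finset.mem_univ _, hyi⟩)).propto

theorem exists_extension_of_finset (hC : IsConical S) (hR : IsRefinement S)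
    (hidem : ∀ x : S, x + x = x) {ι : Type} [Fintype ι] (F : (ι → ℕ) →+ S)
    (t : Finset (ι → ℕ)) :
    ∃ (κ : Type) (_ : Fintype κ) (β : (ι → ℕ) →+ (κ → ℕ)) (G : (κ → ℕ) →+ S),
      G.comp β = F ∧ ∀ y ∈ t, ∀ x, AlgLE (F x) (F y) → Propto (β x) (β y) := by
  classical
  induction t using Finset.induction_on with
  | empty => exact ⟨ι, inferInstance, AddMonoidHom.id _, F, F.comp_id, by simp⟩
  | insert y t _ ih =>
    obtain ⟨κ, _, β, G, rfl, hβ⟩ := ih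
    obtain ⟨μ, _, γ, H, rfl, hγ⟩ := exists_extension_of_element hC hR hidem G (β y)
    refine ⟨μ, inferInstance, γ.comp β, H, rfl, fun z hz x hle => ?_⟩
    obtain rfl | hz := Finset.mem_insert.1 hz
    · exact hγ _ hle
    · exact (hβ z hz x hle).map γ

theorem exists_extension (hC : IsConical S) (hR : IsRefinement S) (hidem : ∀ x : S, x + x = x)
    {r : ℕ} (F : (Fin r → ℕ) →+ S) (s : S) :
    ∃ (q : ℕ) (β : (Fin r → ℕ) →+ (Fin q → ℕ)) (G : (Fin q → ℕ) →+ S),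
      G.comp β = F ∧ (∃ x, G x = s) ∧
        ∀ x y, AlgLE (F x) (F y) → Propto (β x) (β y) := by
  classical
  let F' : (Fin r ⊕ Unit → ℕ) →+ S :=
    simplicialLift (Sum.elim (fun i => F (Pi.single i 1)) fun _ => s)
  let ε : (Fin r → ℕ) →+ (Fin r ⊕ Unit → ℕ) :=
    simplicialLift fun i => Pi.single (Sum.inl i) 1
  have hε : F'.comp ε = F :=
    AddMonoidHom.functions_ext' _ _ _ fun k => AddMonoidHom.ext_nat (by simp [F', ε])
  obtain ⟨κ, _, β, G, hG, hβ⟩ := exists_extension_of_finset hC hR hidem F'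
    (Finset.univ.image simplicialIndicator)
  let e := LinearEquiv.funCongrLeft ℕ ℕ (Fintype.equivFin κ).symm
  refine ⟨Fintype.card κ, e.toLinearMap.toAddMonoidHom.comp (β.comp ε),
    G.comp e.symm.toLinearMap.toAddMonoidHom, ?_,
    ⟨e (β (Pi.single (Sum.inr ()) 1)), ?_⟩, fun x y h => ?_⟩
  · refine AddMonoidHom.ext fun x => ?_
    simp [← hε, ← hG]
  · have : F' (Pi.single (Sum.inr ()) 1) = s := by simp [F']
    simpa [← hG] using this
  · refine Propto.map (x := β (ε x)) (y := β (ε y)) e.toLinearMap.toAddMonoidHom ?_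
    rw [← hε] at h
    refine (hβ _ (Finset.mem_image_of_mem _ (Finset.mem_univ _)) _ ?_).trans
      ((simplicialIndicator_propto (ε y)).map β)
    exact h.trans (((propto_simplicialIndicator (ε y)).map F').algLE_of_idem hidem)

end Extension

section Limit

variable {r : ℕ → ℕ} {β : ∀ j : ℕ, (Fin (r j) → ℕ) →+ (Fin (r (j + 1)) → ℕ)}

theorem IsInductiveLimit.exists_common {Δ : Type*} [AddCommMonoid Δ]
    {φ : ∀ j : ℕ, (Fin (r j) → ℕ) →+ Δ} (h : IsInductiveLimit r β Δ φ) (a b : Δ) :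
    ∃ (j : ℕ) (x y : Fin (r j) → ℕ), φ j x = a ∧ φ j y = b := by
  have hmono : Monotone fun j => AddMonoidHom.mrange (φ j) := by
    refine monotone_nat_of_le_succ fun j => ?_
    rintro _ ⟨x, rfl⟩
    exact ⟨β j x, DFunLike.congr_fun (h.comp_eq j) x⟩
  obtain ⟨j, x, hx⟩ := h.covers a
  obtain ⟨k, y, hy⟩ := h.covers b
  obtain ⟨x', hx'⟩ := hmono (le_max_left j k) ⟨x, hx⟩
  obtain ⟨y', hy'⟩ := hmono (le_max_right j k) ⟨y, hy⟩
  exact ⟨_, x', y', hx', hy'⟩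

variable (β) in
/-- The connecting maps between arbitrary stages of the sequence. -/
def connectingMap (j : ℕ) (k : ℕ) (h : j ≤ k) : (Fin (r j) → ℕ) →+ (Fin (r k) → ℕ) :=
  Nat.leRec (motive := fun m _ => (Fin (r j) → ℕ) →+ (Fin (r m) → ℕ))
    (AddMonoidHom.id _) (fun m _ g => (β m).comp g) h

theorem connectingMap_self (j : ℕ) : connectingMap β j j le_rfl = AddMonoidHom.id _ :=
  Nat.leRec_self _ _

theorem connectingMap_succ {j k : ℕ} (h : j ≤ k) :
    connectingMap β j (k + 1) (Nat.le_succ_of_le h) = (β k).comp (connectingMap β j k h) :=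
  Nat.leRec_succ _ _ h

theorem connectingMap_add (j k : ℕ) :
    connectingMap β j (j + k) (Nat.le_add_right j k) = iterComp r β j k := by
  induction k with
  | zero => exact connectingMap_self j
  | succ k ih => rw [iterComp, ← ih]; exact connectingMap_succ (Nat.le_add_right j k)

theorem connectingMap_comp {i j k : ℕ} (hij : i ≤ j) (hjk : j ≤ k) :
    (connectingMap β j k hjk).comp (connectingMap β i j hij) =
      connectingMap β i k (hij.trans hjk) := by
  induction k, hjk using Nat.le_induction with
  | base => rw [connectingMap_self, AddMonoidHom.id_comp]
  | succ k hjk ih =>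
    rw [connectingMap_succ hjk, connectingMap_succ (hij.trans hjk), AddMonoidHom.comp_assoc, ih]

theorem comp_connectingMap {S : Type*} [AddCommMonoid S] {F : ∀ j, (Fin (r j) → ℕ) →+ S}
    (hF : ∀ j, (F (j + 1)).comp (β j) = F j) {j k : ℕ} (h : j ≤ k) :
    (F k).comp (connectingMap β j k h) = F j := by
  induction k, h using Nat.le_induction with
  | base => rw [connectingMap_self, AddMonoidHom.comp_id]
  | succ k hjk ih => rw [connectingMap_succ hjk, ← AddMonoidHom.comp_assoc, hF, ih]

theorem exists_isInductiveLimit {S : Type*} [AddCommMonoid S] {F : ∀ j, (Fin (r j) → ℕ) →+ S}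
    (hF : ∀ j, (F (j + 1)).comp (β j) = F j) :
    ∃ (N : Type) (_ : AddCommMonoid N) (φ : ∀ j : ℕ, (Fin (r j) → ℕ) →+ N) (α : N →+ S),
      IsInductiveLimit r β N φ ∧ ∀ j x, α (φ j x) = F j x := by
  let f := connectingMap β
  have : DirectedSystem (fun j => Fin (r j) → ℕ) (fun i j h => f i j h) :=
    { map_self := fun i x => DFunLike.congr_fun (connectingMap_self i) x
      map_map := fun _ _ _ hij hjk x => DFunLike.congr_fun (connectingMap_comp hij hjk) x }
  let φ : ∀ j : ℕ, (Fin (r j) → ℕ) →+ DirectLimit (fun j => Fin (r j) → ℕ) f := fun j =>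
    { toFun := fun x => ⟦⟨j, x⟩⟧
      map_zero' := (DirectLimit.zero_def (f := f) j).symm
      map_add' := fun x y => (DirectLimit.add_def (f := f) j x y).symm }
  have hcompat : ∀ i j h x, F i x = F j (f i j h x) := fun i j h x =>
    (DFunLike.congr_fun (comp_connectingMap hF h) x).symm
  refine ⟨DirectLimit (fun j => Fin (r j) → ℕ) f, inferInstance, φ,
    { toFun := DirectLimit.lift f (F · ·) hcompat
      map_zero' := DirectLimit.lift_zero F hcompat
      map_add' := DirectLimit.lift_add F hcompat }, ⟨?_, ?_, ?_⟩, fun _ _ => rfl⟩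
  · intro j
    refine AddMonoidHom.ext fun x => ?_
    have := DirectLimit.mk_apply (f := f) j (j + 1) x (Nat.le_succ j)
    rwa [show f j (j + 1) (Nat.le_succ j) = β j by
      simp only [f, connectingMap_succ le_rfl, connectingMap_self, AddMonoidHom.comp_id]] at this
  · intro d
    obtain ⟨j, x, rfl⟩ := DirectLimit.exists_eq_mk f d
    exact ⟨j, x, rfl⟩
  · intro j x y hxy
    obtain ⟨m, hm, _, h⟩ := Quotient.eq.1 hxy
    obtain ⟨k, rfl⟩ := Nat.exists_eq_add_of_le hm
    exact ⟨k, by rw [← connectingMap_add]; exact h⟩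

end Limit

/-- A countable distributive 0-semilattice `S` (a countable conical refinement
monoid with `x + x = x`) is the image of a dimension monoid `N` under a surjective
monoid homomorphism `α` with `x ∝ y ↔ α x ≤ α y`; consequently `α` identifies the
maximal semilattice quotient `∇(N) = N/≍` (where `x ≍ y` iff `x ∝ y` and `y ∝ x`)
with `S`, this identification being recorded by the last clause:
`α x = α y ↔ (x ≍ y)`. -/
theorem stmt_11 {S : Type*} [AddCommMonoid S] [Countable S]
    (hC : IsConical S) (hR : IsRefinement S)
    (hidem : ∀ x : S, x + x = x) :
    ∃ (r : ℕ → ℕ) (β : ∀ j : ℕ, (Fin (r j) → ℕ) →+ (Fin (r (j + 1)) → ℕ))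
      (N : Type) (_ : AddCommMonoid N),
      ∃ (φ : ∀ j : ℕ, (Fin (r j) → ℕ) →+ N) (α : N →+ S),
        IsInductiveLimit r β N φ ∧
        Function.Surjective α ∧
        (∀ x y : N, Propto x y ↔ AlgLE (α x) (α y)) ∧
        (∀ x y : N, α x = α y ↔ (Propto x y ∧ Propto y x)) := by
  obtain ⟨e, he⟩ := exists_surjective_nat S
  choose q b G hcomp hmem hle using
    fun (p : Σ r : ℕ, (Fin r → ℕ) →+ S) (s : S) => exists_extension hC hR hidem p.2 s
  let stage : ℕ → Σ r : ℕ, (Fin r → ℕ) →+ S := fun n =>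
    Nat.rec ⟨0, 0⟩ (fun n p => ⟨q p (e n), G p (e n)⟩) n
  let β : ∀ j : ℕ, (Fin (stage j).1 → ℕ) →+ (Fin (stage (j + 1)).1 → ℕ) :=
    fun j => b (stage j) (e j)
  obtain ⟨N, _, φ, α, hN, hα⟩ := exists_isInductiveLimit (β := β) (F := fun j => (stage j).2)
    fun j => hcomp (stage j) (e j)
  have key : ∀ x y : N, Propto x y ↔ AlgLE (α x) (α y) := by
    refine fun x y => ⟨fun h => (h.map α).algLE_of_idem hidem, fun h => ?_⟩
    obtain ⟨j, x, y, rfl, rfl⟩ := hN.exists_common x y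
    rw [hα, hα] at h
    rw [← hN.comp_eq j]
    exact (hle _ _ x y h).map (φ (j + 1))
  refine ⟨fun j => (stage j).1, β, N, inferInstance, φ, α, hN, fun s => ?_, key, fun x y => ?_⟩
  · obtain ⟨n, rfl⟩ := he s
    obtain ⟨x, hx⟩ := hmem (stage n) (e n)
    exact ⟨φ (n + 1) x, (hα (n + 1) x).trans hx⟩
  · rw [key, key]
    exact ⟨fun h => h ▸ ⟨AlgLE.refl _, AlgLE.refl _⟩, fun h => h.1.antisymm_of_idem hidem h.2⟩
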